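/- arXiv:1109.3556 — 8 statements merged into one kernel-verified Lean document; each statement's English description precedes it below -/
import Mathlib

section
/- Let ν ≥ 1, λ ∈ ℝ and v ∈ ℝ^ν with v ≠ 0, and define w ∈ ℝ^{2ν} by w_j = v_{ν−j+1} for 1 ≤ j ≤ ν and w_{ν+j} = v_j for 1 ≤ j ≤ ν. Then N_ν v = λ v if and only if M_{2ν} w = λ w. In particular, every eigenvalue of N_ν is an eigenvalue of M_{2ν}. -/
/-- The matrix `N_ν`: symmetric tridiagonal with first diagonal entry 1,
remaining diagonal entries 2, and off-diagonal entries -1. -/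
noncomputable def Nmat (ν : ℕ) : Matrix (Fin ν) (Fin ν) ℝ :=
  Matrix.of fun i j =>
    if i = j then (if (i : ℕ) = 0 then 1 else 2)
    else if (i : ℕ) + 1 = (j : ℕ) ∨ (j : ℕ) + 1 = (i : ℕ) then -1 else 0

/-- The matrix `M_μ`: symmetric tridiagonal with diagonal entries 2 and
off-diagonal entries -1. -/
noncomputable def Mmat (μ : ℕ) : Matrix (Fin μ) (Fin μ) ℝ :=
  Matrix.of fun i j =>
    if i = j then 2
    else if (i : ℕ) + 1 = (j : ℕ) ∨ (j : ℕ) + 1 = (i : ℕ) then -1 else 0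

/-- Extension of a vector by zero to all natural indices. -/
noncomputable def zeroExtend {n : ℕ} (v : Fin n → ℝ) (k : ℕ) : ℝ :=
  if h : k < n then v ⟨k, h⟩ else 0

lemma zeroExtend_coe {n : ℕ} (v : Fin n → ℝ) (i : Fin n) : zeroExtend v i = v i := by
  simp [zeroExtend]

lemma zeroExtend_of_lt {n k : ℕ} (v : Fin n → ℝ) (h : k < n) :
    zeroExtend v k = v ⟨k, h⟩ :=
  dif_pos h

lemma zeroExtend_of_le {n k : ℕ} (v : Fin n → ℝ) (h : n ≤ k) : zeroExtend v k = 0 := by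
  simp [zeroExtend, h]

/-- The vector `(Πv, v)`: the reversal of `v` followed by `v`. -/
noncomputable def mirror {n : ℕ} (v : Fin n → ℝ) (j : Fin (2 * n)) : ℝ :=
  if (j : ℕ) < n then zeroExtend v (n - 1 - j) else zeroExtend v (j - n)

lemma zeroExtend_mirror_of_lt {n k : ℕ} (v : Fin n → ℝ) (h : k < n) :
    zeroExtend (mirror v) k = zeroExtend v (n - 1 - k) := by
  have h1 : k < 2 * n := by omega
  have h2 : n - 1 - k < n := by omega
  simp [zeroExtend, mirror, h, h1, h2]

lemma zeroExtend_mirror_of_le {n k : ℕ} (v : Fin n → ℝ) (h : n ≤ k) :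
    zeroExtend (mirror v) k = zeroExtend v (k - n) := by
  by_cases h1 : k < 2 * n
  · have h2 : k - n < n := by omega
    simp [zeroExtend, mirror, h.not_gt, h1, h2]
  · rw [zeroExtend_of_le _ (by omega), zeroExtend_of_le _ (by omega)]

lemma mirror_injective (n : ℕ) : Function.Injective (mirror (n := n)) := by
  intro u v h
  funext i
  have h1 := congrArg (fun z => zeroExtend z (n + i)) h
  simpa [zeroExtend_mirror_of_le, zeroExtend_coe] using h1

lemma mirror_smul {n : ℕ} (c : ℝ) (v : Fin n → ℝ) : mirror (c • v) = c • mirror v := by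
  funext j
  simp only [mirror, zeroExtend, Pi.smul_apply, smul_eq_mul]
  split_ifs <;> simp

lemma sum_ite_eq_zeroExtend {n : ℕ} (v : Fin n → ℝ) (k : ℕ) :
    ∑ j : Fin n, (if (j : ℕ) = k then v j else 0) = zeroExtend v k := by
  by_cases h : k < n
  · rw [Finset.sum_eq_single ⟨k, h⟩]
    · simp [zeroExtend, h]
    · intro j _ hj
      rw [if_neg (fun e => hj (Fin.ext e))]
    · simp
  · rw [zeroExtend_of_le _ (not_lt.mp h)]
    refine Finset.sum_eq_zero fun j _ => if_neg ?_
    have := j.isLt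
    omega

lemma Mmat_mulVec_apply {n : ℕ} (v : Fin n → ℝ) (i : Fin n) :
    (Mmat n).mulVec v i = 2 * zeroExtend v i
      - (if (i : ℕ) = 0 then 0 else zeroExtend v (i - 1)) - zeroExtend v (i + 1) := by
  have key : ∀ j : Fin n, Mmat n i j * v j = 2 * (if (j : ℕ) = i then v j else 0)
      - (if (i : ℕ) = 0 then 0 else if (j : ℕ) = i - 1 then v j else 0)
      - (if (j : ℕ) = i + 1 then v j else 0) := by
    intro j
    simp only [Mmat, Matrix.of_apply, Fin.ext_iff]
    split_ifs <;> first | omega | ring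
  simp only [Matrix.mulVec, dotProduct, key, Finset.sum_sub_distrib, ← Finset.mul_sum,
    sum_ite_eq_zeroExtend]
  split_ifs <;> simp [sum_ite_eq_zeroExtend]

/-- Truncated subtraction `0 - 1 = 0` accounts for the corner entry of `Nmat`. -/
lemma Nmat_mulVec_apply {n : ℕ} (v : Fin n → ℝ) (i : Fin n) :
    (Nmat n).mulVec v i =
      2 * zeroExtend v i - zeroExtend v (i - 1) - zeroExtend v (i + 1) := by
  have key : ∀ j : Fin n, Nmat n i j * v j = 2 * (if (j : ℕ) = i then v j else 0)
      - (if (j : ℕ) = i - 1 then v j else 0) - (if (j : ℕ) = i + 1 then v j else 0) := by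
    intro j
    simp only [Nmat, Matrix.of_apply, Fin.ext_iff]
    split_ifs <;> first | omega | ring
  simp only [Matrix.mulVec, dotProduct, key, Finset.sum_sub_distrib, ← Finset.mul_sum,
    sum_ite_eq_zeroExtend]

lemma Mmat_mulVec_mirror {n : ℕ} (v : Fin n → ℝ) :
    (Mmat (2 * n)).mulVec (mirror v) = mirror ((Nmat n).mulVec v) := by
  funext j
  have hj := j.isLt
  rw [Mmat_mulVec_apply]
  by_cases h : (j : ℕ) < n
  · have hi : n - 1 - (j : ℕ) < n := by omega
    rw [mirror, if_pos h, zeroExtend_of_lt _ hi, Nmat_mulVec_apply, zeroExtend_mirror_of_lt v h]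
    have hprev : (if (j : ℕ) = 0 then 0 else zeroExtend (mirror v) (j - 1))
        = zeroExtend v (n - 1 - j + 1) := by
      split_ifs with h0
      · rw [zeroExtend_of_le v (by omega)]
      · rw [zeroExtend_mirror_of_lt v (by omega)]
        congr 1
        omega
    have hnext : zeroExtend (mirror v) (j + 1) = zeroExtend v (n - 1 - j - 1) := by
      by_cases h1 : (j : ℕ) + 1 < n
      · rw [zeroExtend_mirror_of_lt v h1]
        congr 1
      · rw [zeroExtend_mirror_of_le v (by omega)]
        congr 1
        omega
    rw [hprev, hnext]
    ring
  · have hi : (j : ℕ) - n < n := by omega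
    rw [mirror, if_neg h, zeroExtend_of_lt _ hi, Nmat_mulVec_apply, zeroExtend_mirror_of_le v (by omega),
      zeroExtend_mirror_of_le v (by omega : n ≤ (j : ℕ) + 1), if_neg (by omega)]
    have hprev : zeroExtend (mirror v) (j - 1) = zeroExtend v (j - n - 1) := by
      by_cases h1 : n ≤ (j : ℕ) - 1
      · rw [zeroExtend_mirror_of_le v h1]
        congr 1
        omega
      · rw [zeroExtend_mirror_of_lt v (by omega)]
        congr 1
        omega
    rw [hprev, show (j : ℕ) + 1 - n = j - n + 1 by omega]

lemma Nmat_mulVec_eq_smul_iff {n : ℕ} (c : ℝ) (v : Fin n → ℝ) :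
    (Nmat n).mulVec v = c • v ↔ (Mmat (2 * n)).mulVec (mirror v) = c • mirror v := by
  rw [Mmat_mulVec_mirror, ← mirror_smul, (mirror_injective n).eq_iff]

/-- For `w = (Πv, v)` (first half of `w` is `v` reversed, second half is `v`),
`N_ν v = λ v ↔ M_{2ν} w = λ w`; in particular every eigenvalue of `N_ν` is an
eigenvalue of `M_{2ν}`. -/
theorem stmt1 (ν : ℕ) (hν : 1 ≤ ν) (lam : ℝ) (v : Fin ν → ℝ) (hv : v ≠ 0)
    (w : Fin (2 * ν) → ℝ)
    (hw : ∀ j : Fin (2 * ν),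
      w j = if h : (j : ℕ) < ν then v ⟨ν - 1 - (j : ℕ), by omega⟩
            else v ⟨(j : ℕ) - ν, by have := j.isLt; omega⟩) :
    ((Nmat ν).mulVec v = lam • v ↔ (Mmat (2 * ν)).mulVec w = lam • w) ∧
    (∀ μl : ℝ, (∃ u : Fin ν → ℝ, u ≠ 0 ∧ (Nmat ν).mulVec u = μl • u) →
      (∃ z : Fin (2 * ν) → ℝ, z ≠ 0 ∧ (Mmat (2 * ν)).mulVec z = μl • z)) := by
  obtain rfl : w = mirror v := by
    funext j
    have hj := j.isLt
    rw [hw j, mirror]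
    split_ifs
    · exact (zeroExtend_of_lt v (by omega)).symm
    · exact (zeroExtend_of_lt v (by omega)).symm
  refine ⟨Nmat_mulVec_eq_smul_iff lam v, ?_⟩
  rintro c ⟨u, hu, h⟩
  refine ⟨mirror u, fun h0 => hu (mirror_injective ν ?_), (Nmat_mulVec_eq_smul_iff c u).mp h⟩
  rw [h0]
  funext j
  simp [mirror, zeroExtend]
end

section
/- For every n ≥ 2, the characteristic polynomial of the path Laplacian factors as det(sI − L_n) = s · det(sI − M_{n−1}) as an identity of polynomials in s. -/
/-- The Laplacian `L_n` of the path graph on `n` nodes. -/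
noncomputable def Lpath (n : ℕ) : Matrix (Fin n) (Fin n) ℝ :=
  Matrix.of fun i j =>
    if i = j then (if (i : ℕ) = 0 ∨ (i : ℕ) = n - 1 then 1 else 2)
    else if (i : ℕ) + 1 = (j : ℕ) ∨ (j : ℕ) + 1 = (i : ℕ) then -1 else 0

/-- The oriented incidence matrix of the path graph on `m + 1` nodes. -/
def pathIncidence (m : ℕ) : Matrix (Fin (m + 1)) (Fin m) ℝ :=
  Matrix.of fun i k =>
    (if (i : ℕ) = (k : ℕ) then 1 else 0) - (if (i : ℕ) = (k : ℕ) + 1 then 1 else 0)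

theorem pathIncidence_mul_transpose (m : ℕ) (hm : 1 ≤ m) :
    pathIncidence m * (pathIncidence m).transpose = Lpath (m + 1) := by
  ext ⟨i, hi⟩ ⟨j, hj⟩
  simp only [Matrix.mul_apply, pathIncidence, Matrix.transpose_apply, Matrix.of_apply, Lpath,
    Fin.mk.injEq]
  rw [Fin.sum_univ_eq_sum_range (fun k : ℕ =>
    ((if i = k then (1 : ℝ) else 0) - (if i = k + 1 then 1 else 0)) *
      ((if j = k then 1 else 0) - (if j = k + 1 then 1 else 0))) m]
  rcases i with _ | i <;>
    simp only [sub_mul, ite_mul, one_mul, zero_mul, Finset.sum_sub_distrib, Finset.sum_ite_eq,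
      Finset.mem_range, add_left_inj, (Nat.succ_ne_zero _).symm, if_false,
      Finset.sum_const_zero] <;>
    grind

theorem transpose_mul_pathIncidence (m : ℕ) :
    (pathIncidence m).transpose * pathIncidence m = Mmat m := by
  ext ⟨i, hi⟩ ⟨j, hj⟩
  simp only [Matrix.mul_apply, pathIncidence, Matrix.transpose_apply, Matrix.of_apply, Mmat,
    Fin.mk.injEq]
  rw [Fin.sum_univ_eq_sum_range (fun k : ℕ =>
    ((if k = i then (1 : ℝ) else 0) - (if k = i + 1 then 1 else 0)) *
      ((if k = j then 1 else 0) - (if k = j + 1 then 1 else 0))) (m + 1)]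
  simp only [sub_mul, ite_mul, one_mul, zero_mul, Finset.sum_sub_distrib, Finset.sum_ite_eq',
    Finset.mem_range]
  grind

/-- `det(sI − L_n) = s · det(sI − M_{n−1})`.
Here `Matrix.charpoly A = det (s I - A)`. -/
theorem stmt6 (n : ℕ) (hn : 2 ≤ n) :
    (Lpath n).charpoly = Polynomial.X * (Mmat (n - 1)).charpoly := by
  obtain ⟨m, rfl⟩ : ∃ m, n = m + 1 := ⟨n - 1, by lia⟩
  rw [Nat.add_sub_cancel, ← pathIncidence_mul_transpose m (by lia),
    ← transpose_mul_pathIncidence, Matrix.charpoly_mul_comm_of_le _ _ (by simp)]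
  simp
end

section
/- Let n ≥ 3 and let i ∈ {2,...,n−1}. The path graph of length n is observable from the single node i (i.e. the only x ∈ ℝ^n with (L_n^k x)_i = 0 for all k ∈ ℕ is x = 0) if and only if the matrices N_{i−1} and N_{n−i} have no common eigenvalue. -/
/-- `lam` is an eigenvalue of the real matrix `A`. -/
def IsEigen {d : ℕ} (A : Matrix (Fin d) (Fin d) ℝ) (lam : ℝ) : Prop :=
  ∃ v : Fin d → ℝ, v ≠ 0 ∧ A.mulVec v = lam • v

/-- The solution, normalised to start with `1`, of the recurrence satisfied by eigenvectors of
`Lpath` and `Nmat` when read from an end of the path. -/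
noncomputable def pathSeq (lam : ℝ) : ℕ → ℝ
  | 0 => 1
  | 1 => 1 - lam
  | k + 2 => (2 - lam) * pathSeq lam (k + 1) - pathSeq lam k

/-- `f` solves the eigenvector recurrence at `lam` up to index `N`. -/
def SolvesUpTo (lam : ℝ) (N : ℕ) (f : ℕ → ℝ) : Prop :=
  (1 ≤ N → f 1 = (1 - lam) * f 0) ∧ ∀ k, k + 2 ≤ N → f (k + 2) = (2 - lam) * f (k + 1) - f k

theorem solvesUpTo_pathSeq (lam c : ℝ) (N : ℕ) : SolvesUpTo lam N fun k => c * pathSeq lam k := by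
  refine ⟨fun _ => ?_, fun k _ => ?_⟩ <;> simp only [pathSeq] <;> ring

theorem SolvesUpTo.congr {lam : ℝ} {N : ℕ} {f g : ℕ → ℝ} (hg : SolvesUpTo lam N g)
    (h : ∀ k, k ≤ N → f k = g k) : SolvesUpTo lam N f := by
  refine ⟨fun hN => ?_, fun k hk => ?_⟩
  · rw [h 1 hN, h 0 (Nat.zero_le N), hg.1 hN]
  · rw [h _ hk, h (k + 1) (by omega), h k (by omega), hg.2 k hk]

theorem SolvesUpTo.eq_mul_pathSeq {lam : ℝ} {N : ℕ} {f : ℕ → ℝ} (h : SolvesUpTo lam N f) :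
    ∀ k, k ≤ N → f k = f 0 * pathSeq lam k := by
  intro k
  induction k using Nat.strong_induction_on with
  | _ k ih =>
    intro hk
    match k with
    | 0 => simp [pathSeq]
    | 1 => rw [h.1 hk, pathSeq]; ring
    | k + 2 =>
      rw [h.2 k hk, ih (k + 1) (by omega) (by omega), ih k (by omega) (by omega), pathSeq]
      ring

theorem pathSeq_succ_ne_zero {lam : ℝ} (k : ℕ) (h : pathSeq lam k = 0) :
    pathSeq lam (k + 1) ≠ 0 := by
  induction k with
  | zero => simp [pathSeq] at h
  | succ k ih =>
    intro h2
    rw [pathSeq, h] at h2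
    exact ih (by linarith) h

theorem sum_tridiagonal_mul {n : ℕ} (i : Fin n) (d : ℝ) (f : ℕ → ℝ) :
    ∑ j : Fin n, (if i = j then d else
      if (i : ℕ) + 1 = (j : ℕ) ∨ (j : ℕ) + 1 = (i : ℕ) then -1 else 0) * f j =
    d * f i - (if (i : ℕ) + 1 < n then f (i + 1) else 0)
      - (if 0 < (i : ℕ) then f (i - 1) else 0) := by
  obtain ⟨i, hi⟩ := i
  have h : ∀ j : Fin n, (if (⟨i, hi⟩ : Fin n) = j then d else
      if i + 1 = (j : ℕ) ∨ (j : ℕ) + 1 = i then -1 else 0) * f j =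
      (if i = (j : ℕ) then d * f j else 0) - (if i + 1 = (j : ℕ) then f j else 0)
      - (if 0 < i then (if i - 1 = (j : ℕ) then f j else 0) else 0) := by
    intro j
    simp only [Fin.ext_iff]
    split_ifs <;> first | omega | ring
  simp only [h]
  rw [Fin.sum_univ_eq_sum_range (fun j => (if i = j then d * f j else 0)
    - (if i + 1 = j then f j else 0)
    - (if 0 < i then (if i - 1 = j then f j else 0) else 0)) n]
  rw [Finset.sum_sub_distrib, Finset.sum_sub_distrib]
  by_cases h0 : 0 < i
  · have : i - 1 < n := by omega
    simp [h0, hi, this]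
  · simp [h0, hi]

theorem Lpath_mulVec_eq_iff {m r : ℕ} (hm : 1 ≤ m) (hr : 1 ≤ r) {n : ℕ} (hn : n = m + 1 + r)
    (lam : ℝ) (f : ℕ → ℝ) :
    (Lpath n).mulVec (fun j => f j) = lam • (fun j : Fin n => f j) ↔
      SolvesUpTo lam m f ∧ SolvesUpTo lam r (fun k => f (n - 1 - k)) ∧
        f (m + 1) = (2 - lam) * f m - f (m - 1) := by
  have key : (Lpath n).mulVec (fun j => f j) = lam • (fun j : Fin n => f j) ↔
      ∀ k, k < n → (if k = 0 ∨ k = n - 1 then 1 else 2) * f k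
        - (if k + 1 < n then f (k + 1) else 0) - (if 0 < k then f (k - 1) else 0) = lam * f k := by
    rw [funext_iff, Fin.forall_iff]
    refine forall₂_congr fun k hk => ?_
    simp only [Matrix.mulVec, dotProduct, Lpath, Matrix.of_apply, Pi.smul_apply, smul_eq_mul]
    rw [sum_tridiagonal_mul ⟨k, hk⟩]
  rw [key]
  constructor
  · intro h
    refine ⟨⟨fun _ => ?_, fun k hk => ?_⟩, ⟨fun _ => ?_, fun k hk => ?_⟩, ?_⟩
    · have := h 0 (by omega)
      rw [if_pos (by omega), if_pos (by omega), if_neg (by omega)] at this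
      linarith
    · have := h (k + 1) (by omega)
      rw [if_neg (by omega), if_pos (by omega), if_pos (by omega)] at this
      simp only [Nat.add_sub_cancel] at this
      linarith
    · have := h (n - 1) (by omega)
      rw [if_pos (by omega), if_neg (by omega), if_pos (by omega)] at this
      simp only [Nat.sub_zero]
      linarith
    · have := h (n - 1 - (k + 1)) (by omega)
      rw [if_neg (by omega), if_pos (by omega), if_pos (by omega),
        show n - 1 - (k + 1) + 1 = n - 1 - k by omega,
        show n - 1 - (k + 1) - 1 = n - 1 - (k + 2) by omega] at this
      dsimp only
      linarith
    · have := h m (by omega)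
      rw [if_neg (by omega), if_pos (by omega), if_pos (by omega)] at this
      linarith
  · rintro ⟨⟨h1, h2⟩, ⟨h3, h4⟩, h5⟩ k hk
    rcases Nat.lt_trichotomy k m with hkm | rfl | hkm
    · rcases k with _ | k
      · rw [if_pos (by omega), if_pos (by omega), if_neg (by omega)]
        have := h1 hm
        simp only [zero_add]
        linarith
      · rw [if_neg (by omega), if_pos (by omega), if_pos (by omega)]
        have := h2 k (by omega)
        simp only [Nat.add_sub_cancel]
        linarith
    · rw [if_neg (by omega), if_pos (by omega), if_pos (by omega)]
      linarith
    · by_cases hkn : k = n - 1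
      · rw [if_pos (by omega), if_neg (by omega), if_pos (by omega)]
        have := h3 hr
        simp only [Nat.sub_zero, ← hkn] at this
        linarith
      · rw [if_neg (by omega), if_pos (by omega), if_pos (by omega)]
        have := h4 (n - 2 - k) (by omega)
        simp only [show n - 1 - (n - 2 - k + 2) = k - 1 by omega,
          show n - 1 - (n - 2 - k + 1) = k by omega,
          show n - 1 - (n - 2 - k) = k + 1 by omega] at this
        linarith

theorem Nmat_mulVec_eq_iff {ν : ℕ} (hν : 1 ≤ ν) (lam : ℝ) (f : ℕ → ℝ) (hf : f ν = 0) :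
    (Nmat ν).mulVec (fun j => f j) = lam • (fun j : Fin ν => f j) ↔ SolvesUpTo lam ν f := by
  have key : (Nmat ν).mulVec (fun j => f j) = lam • (fun j : Fin ν => f j) ↔
      ∀ k, k < ν → (if k = 0 then 1 else 2) * f k
        - f (k + 1) - (if 0 < k then f (k - 1) else 0) = lam * f k := by
    rw [funext_iff, Fin.forall_iff]
    refine forall₂_congr fun k hk => ?_
    simp only [Matrix.mulVec, dotProduct, Nmat, Matrix.of_apply, Pi.smul_apply, smul_eq_mul]
    rw [sum_tridiagonal_mul ⟨k, hk⟩]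
    have : (if k + 1 < ν then f (k + 1) else 0) = f (k + 1) := by
      split_ifs with h
      · rfl
      · rw [show k + 1 = ν by omega, hf]
    simp only [this]
  rw [key]
  constructor
  · intro h
    refine ⟨fun _ => ?_, fun k hk => ?_⟩
    · have := h 0 hν
      simp only [if_true, lt_irrefl, if_false, zero_add] at this
      linarith
    · have := h (k + 1) (by omega)
      rw [if_neg (by omega), if_pos (by omega), Nat.add_sub_cancel] at this
      linarith
  · rintro ⟨h1, h2⟩ k hk
    rcases k with _ | k
    · have := h1 hν
      simp only [if_true, lt_irrefl, if_false, zero_add]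
      linarith
    · rw [if_neg (by omega), if_pos (by omega), Nat.add_sub_cancel]
      have := h2 k (by omega)
      linarith

/-- Extension by zero of a vector to a sequence. -/
noncomputable def extendZero {n : ℕ} (x : Fin n → ℝ) (k : ℕ) : ℝ :=
  if h : k < n then x ⟨k, h⟩ else 0

theorem extendZero_val {n : ℕ} (x : Fin n → ℝ) : (fun j : Fin n => extendZero x j) = x := by
  funext j
  simp [extendZero]

theorem isEigen_Nmat_iff {ν : ℕ} (hν : 1 ≤ ν) (lam : ℝ) :
    IsEigen (Nmat ν) lam ↔ pathSeq lam ν = 0 := by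
  constructor
  · rintro ⟨v, hv, h⟩
    have hf : extendZero v ν = 0 := by simp [extendZero]
    rw [← extendZero_val v, Nmat_mulVec_eq_iff hν lam _ hf] at h
    have hs := h.eq_mul_pathSeq
    have h0 : extendZero v 0 ≠ 0 := by
      intro h0
      apply hv
      rw [← extendZero_val v]
      funext j
      rw [hs j j.2.le, h0, zero_mul, Pi.zero_apply]
    rw [hs ν le_rfl] at hf
    exact (mul_eq_zero.mp hf).resolve_left h0
  · intro h
    refine ⟨fun j => 1 * pathSeq lam j, fun h0 => ?_,
      (Nmat_mulVec_eq_iff hν lam (fun k => 1 * pathSeq lam k) (by simp [h])).2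
        (solvesUpTo_pathSeq lam 1 ν)⟩
    simpa [pathSeq] using congrFun h0 ⟨0, hν⟩

theorem Lpath_isSymm (n : ℕ) : (Lpath n).IsSymm := by
  ext i j
  simp only [Matrix.transpose_apply, Lpath, Matrix.of_apply]
  by_cases h : i = j
  · rw [h]
  · rw [if_neg h, if_neg (Ne.symm h)]
    simp only [or_comm]

/-- The Hautus test for a real symmetric matrix observed at one coordinate. -/
theorem exists_eigenvector_of_unobservable {n : ℕ} {A : Matrix (Fin n) (Fin n) ℝ}
    (hA : A.IsSymm) (m : Fin n) {x : Fin n → ℝ} (hx : x ≠ 0)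
    (h : ∀ k : ℕ, (A ^ k).mulVec x m = 0) :
    ∃ (lam : ℝ) (v : Fin n → ℝ), v ≠ 0 ∧ v m = 0 ∧ A.mulVec v = lam • v := by
  let T := Matrix.toEuclideanLin A
  have hT : T.IsSymmetric := Matrix.isSymmetric_toEuclideanLin_iff.2 (by
    rw [Matrix.IsHermitian, Matrix.conjTranspose_eq_transpose_of_trivial]; exact hA)
  let V : Submodule ℝ (EuclideanSpace ℝ (Fin n)) :=
    { carrier := {y | ∀ k : ℕ, (A ^ k).mulVec y.ofLp m = 0}
      add_mem' := fun {a b} ha hb k => by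
        simp [Matrix.mulVec_add, ha k, hb k]
      zero_mem' := fun k => by simp
      smul_mem' := fun c y hy k => by simp [Matrix.mulVec_smul, hy k] }
  have hV : ∀ y ∈ V, T y ∈ V := fun y hy k => by
    have := hy (k + 1)
    rw [pow_succ, ← Matrix.mulVec_mulVec] at this
    exact this
  have hxV : WithLp.toLp 2 x ∈ V := h
  have : Nontrivial V := ⟨⟨⟨_, hxV⟩, 0, fun h0 => hx (by
    simpa using congrArg (fun y : V => (y : EuclideanSpace ℝ (Fin n)).ofLp) h0)⟩⟩
  obtain ⟨lam, hlam⟩ : ∃ lam : ℝ, Module.End.HasEigenvalue (T.restrict hV) lam :=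
    ⟨_, (hT.restrict_invariant hV).hasEigenvalue_iSup_of_finiteDimensional⟩
  obtain ⟨v, hv⟩ := hlam.exists_hasEigenvector
  refine ⟨lam, (v : EuclideanSpace ℝ (Fin n)).ofLp, ?_, ?_, ?_⟩
  · exact fun h0 => hv.2 (Subtype.ext (WithLp.ofLp_injective 2 h0))
  · simpa using v.2 0
  · exact congrArg (fun y : V => (y : EuclideanSpace ℝ (Fin n)).ofLp) hv.apply_eq_smul

theorem pow_mulVec_of_eigenvector {n : ℕ} {A : Matrix (Fin n) (Fin n) ℝ} {v : Fin n → ℝ} {lam : ℝ}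
    (h : A.mulVec v = lam • v) (k : ℕ) : (A ^ k).mulVec v = lam ^ k • v := by
  induction k with
  | zero => simp
  | succ k ih => rw [pow_succ, ← Matrix.mulVec_mulVec, h, Matrix.mulVec_smul, ih, smul_smul,
    pow_succ']

theorem exists_Lpath_eigenvector_iff {m r n : ℕ} (hm : 1 ≤ m) (hr : 1 ≤ r) (hn : n = m + 1 + r)
    (hmn : m < n) (lam : ℝ) :
    (∃ v : Fin n → ℝ, v ≠ 0 ∧ v ⟨m, hmn⟩ = 0 ∧ (Lpath n).mulVec v = lam • v) ↔
      pathSeq lam m = 0 ∧ pathSeq lam r = 0 := by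
  obtain ⟨m, rfl⟩ := Nat.exists_eq_add_of_le' hm
  obtain ⟨r, rfl⟩ := Nat.exists_eq_add_of_le' hr
  constructor
  · rintro ⟨v, hv, hvm, h⟩
    obtain ⟨f, rfl⟩ : ∃ f : ℕ → ℝ, v = fun j : Fin n => f j := ⟨_, (extendZero_val v).symm⟩
    rw [Lpath_mulVec_eq_iff hm hr hn] at h
    obtain ⟨h1, h2, h3⟩ := h
    replace h1 := h1.eq_mul_pathSeq
    replace h2 := h2.eq_mul_pathSeq
    replace hvm : f (m + 1) = 0 := hvm
    simp only [Nat.sub_zero] at h2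
    have e1 := h1 (m + 1) le_rfl
    have e2 := h2 (r + 1) le_rfl
    have e3 := h1 m (by omega)
    have e4 := h2 r (by omega)
    rw [show n - 1 - (r + 1) = m + 1 by omega] at e2
    rw [show n - 1 - r = m + 1 + 1 by omega] at e4
    rw [hvm] at e1 e2
    rw [hvm, e4, Nat.add_sub_cancel, e3] at h3
    have hne : ¬ (f 0 = 0 ∧ f (n - 1) = 0) := by
      rintro ⟨ha, hb⟩
      apply hv
      funext j
      rcases Nat.lt_or_ge j (m + 1) with hj | hj
      · simp [h1 j hj.le, ha]
      · have := h2 (n - 1 - j) (by omega)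
        rw [show n - 1 - (n - 1 - j) = j by omega] at this
        simp [this, hb]
    have ha : f 0 ≠ 0 := by
      intro ha
      have hb : f (n - 1) ≠ 0 := fun hb => hne ⟨ha, hb⟩
      simp [ha, hb] at h3
      simp [hb] at e2
      exact pathSeq_succ_ne_zero r h3 e2
    have hb : f (n - 1) ≠ 0 := by
      intro hb
      simp [ha, hb] at h3
      simp [ha] at e1
      exact pathSeq_succ_ne_zero m h3 e1
    exact ⟨(mul_eq_zero.1 e1.symm).resolve_left ha, (mul_eq_zero.1 e2.symm).resolve_left hb⟩
  · rintro ⟨hpm, hpr⟩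
    have hr0 : pathSeq lam r ≠ 0 := fun h => pathSeq_succ_ne_zero r h hpr
    let f : ℕ → ℝ := fun k => if k ≤ m + 1 then pathSeq lam r * pathSeq lam k
      else -pathSeq lam m * pathSeq lam (n - 1 - k)
    have f1 : ∀ k, k ≤ m + 1 → f k = pathSeq lam r * pathSeq lam k := fun k hk => if_pos hk
    have f2 : ∀ k, k ≤ r + 1 → f (n - 1 - k) = -pathSeq lam m * pathSeq lam k := by
      intro k hk
      rcases hk.eq_or_lt with rfl | hk
      · rw [f1 _ (by omega), show n - 1 - (r + 1) = m + 1 by omega, hpm, hpr]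
        simp
      · simp only [f]
        rw [if_neg (by omega), show n - 1 - (n - 1 - k) = k by omega]
    refine ⟨fun j => f j, fun h0 => ?_, ?_, (Lpath_mulVec_eq_iff hm hr hn lam f).2 ⟨?_, ?_, ?_⟩⟩
    · have := congrFun h0 ⟨0, by omega⟩
      simp only [f1 0 (by omega), pathSeq, mul_one, Pi.zero_apply] at this
      exact hr0 this
    · simp [f1, hpm]
    · exact (solvesUpTo_pathSeq lam _ _).congr f1
    · exact (solvesUpTo_pathSeq lam _ _).congr f2
    · have e := f2 r (by omega)
      rw [show n - 1 - r = m + 1 + 1 by omega] at e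
      rw [e, f1 _ le_rfl, f1 _ (by omega), hpm, Nat.add_sub_cancel]
      ring

/-- The path of length `n` is observable from the single (internal) node `i`
iff `N_{i-1}` and `N_{n-i}` have no common eigenvalue. (Node `i ∈ {1,...,n}`
corresponds to the index `i-1 : Fin n`.) -/
theorem stmt9 (n : ℕ) (hn : 3 ≤ n) (i : ℕ) (hi2 : 2 ≤ i) (hi : i ≤ n - 1) :
    (∀ x : Fin n → ℝ,
        (∀ k : ℕ, ((Lpath n) ^ k).mulVec x ⟨i - 1, by omega⟩ = 0) → x = 0) ↔
    ¬ ∃ lam : ℝ, IsEigen (Nmat (i - 1)) lam ∧ IsEigen (Nmat (n - i)) lam := by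
  have key := exists_Lpath_eigenvector_iff (m := i - 1) (r := n - i) (n := n)
    (by omega) (by omega) (by omega) (by omega)
  simp only [isEigen_Nmat_iff (show 1 ≤ i - 1 by omega), isEigen_Nmat_iff (show 1 ≤ n - i by omega),
    ← key]
  constructor
  · rintro h ⟨lam, v, hv, hvm, he⟩
    exact hv (h v fun k => by rw [pow_mulVec_of_eigenvector he, Pi.smul_apply, hvm, smul_zero])
  · intro h x hx
    by_contra hx0
    exact h (exists_eigenvector_of_unobservable (Lpath_isSymm n) _ hx0 hx)
end

section
/- Let n ≥ 3 and let 2 ≤ i_1 < i_2 < ... < i_m ≤ n−1 be observation nodes. The path graph of length n is observable from the set {i_1,...,i_m} (i.e. the only x ∈ ℝ^n with (L_n^k x)_{i_j} = 0 for all k ∈ ℕ and all j ∈ {1,...,m} is x = 0) if and only if there is no real number λ that is simultaneously an eigenvalue of all of the matrices N_{i_1−1}, M_{i_2−i_1−1}, ..., M_{i_m−i_{m−1}−1}, and N_{n−i_m} (matrices of size 0 have no eigenvalues). -/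
/-- The sequence with `g 0 = a`, `g 1 = 1` and `g (k + 2) = t * g (k + 1) - g k`. -/
noncomputable def tridiagSeq (a t : ℝ) : ℕ → ℝ
  | 0 => a
  | 1 => 1
  | k + 2 => t * tridiagSeq a t (k + 1) - tridiagSeq a t k

/-- The `d × d` tridiagonal matrix with off-diagonal entries `-1` and diagonal entries `2`, except
that `a` is subtracted from the first and `b` from the last diagonal entry. -/
noncomputable def tridiag (d : ℕ) (a b : ℝ) : Matrix (Fin d) (Fin d) ℝ :=
  Matrix.of fun i j =>
    if i = j then 2 - (if (i : ℕ) = 0 then a else 0) - (if (i : ℕ) + 1 = d then b else 0)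
    else if (i : ℕ) + 1 = (j : ℕ) ∨ (j : ℕ) + 1 = (i : ℕ) then -1 else 0

theorem Nmat_eq_tridiag (d : ℕ) : Nmat d = tridiag d 1 0 := by
  ext i j
  simp only [Nmat, tridiag, Matrix.of_apply]
  split_ifs <;> norm_num

theorem Mmat_eq_tridiag (d : ℕ) : Mmat d = tridiag d 0 0 := by
  ext i j
  simp only [Mmat, tridiag, Matrix.of_apply]
  split_ifs <;> norm_num

theorem Lpath_eq_tridiag {n : ℕ} (hn : 2 ≤ n) : Lpath n = tridiag n 1 1 := by
  ext i j
  simp only [Lpath, tridiag, Matrix.of_apply]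
  split_ifs <;> first | omega | norm_num

theorem tridiag_mulVec {d : ℕ} {a b : ℝ} {f : ℕ → ℝ} (h0 : f 0 = a * f 1)
    (hd : f (d + 1) = b * f d) (i : Fin d) :
    (tridiag d a b).mulVec (fun j => f (j + 1)) i = 2 * f (i + 1) - f i - f (i + 2) := by
  obtain ⟨i, hi⟩ := i
  have hentry : ∀ j : Fin d, tridiag d a b ⟨i, hi⟩ j * f (j + 1) =
      (if i = (j : ℕ) then
        (2 - (if i = 0 then a else 0) - (if i + 1 = d then b else 0)) * f (j + 1) else 0)
      - (if i + 1 = (j : ℕ) then f (j + 1) else 0)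
      - (if i = (j : ℕ) + 1 then f (j + 1) else 0) := by
    rintro ⟨j, hj⟩
    simp only [tridiag, Matrix.of_apply, Fin.mk.injEq]
    split_ifs <;> first | omega | ring
  have hlast : ∑ j ∈ Finset.range d, (if i = j + 1 then f (j + 1) else 0) =
      if i = 0 then 0 else f i := by
    cases i with
    | zero => simp
    | succ i => simp [show i < d by omega]
  rw [Matrix.mulVec, dotProduct, Finset.sum_congr rfl fun j _ => hentry j,
    Fin.sum_univ_eq_sum_range fun j => (if i = j then
        (2 - (if i = 0 then a else 0) - (if i + 1 = d then b else 0)) * f (j + 1) else 0)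
      - (if i + 1 = j then f (j + 1) else 0) - (if i = j + 1 then f (j + 1) else 0)]
  rw [Finset.sum_sub_distrib, Finset.sum_sub_distrib, hlast, Finset.sum_ite_eq, Finset.sum_ite_eq]
  simp only [Finset.mem_range, hi, if_true]
  by_cases hi0 : i = 0
  · subst hi0
    by_cases hid : 0 + 1 = d
    · subst hid
      simp at h0 hd ⊢
      linarith
    · simp [hid, show 1 < d by omega]
      linarith
  · by_cases hid : i + 1 = d
    · subst hid
      simp [hi0] at hd ⊢
      linarith
    · simp [hi0, hid, show i + 1 < d by omega]
      ring

theorem eq_mul_tridiagSeq {f : ℕ → ℝ} {a t : ℝ} (h0 : f 0 = a * f 1) {d : ℕ}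
    (hrec : ∀ k < d, f (k + 2) = t * f (k + 1) - f k) :
    ∀ k ≤ d + 1, f k = f 1 * tridiagSeq a t k := by
  intro k
  induction k using Nat.strong_induction_on with
  | _ k ih =>
    intro hk
    match k, ih, hk with
    | 0, _, _ => rw [h0, tridiagSeq]; ring
    | 1, _, _ => simp [tridiagSeq]
    | k + 2, ih, hk =>
      rw [hrec k (by omega), ih (k + 1) (by omega) (by omega), ih k (by omega) (by omega),
        tridiagSeq]
      ring

theorem tridiag_mulVec_tridiagSeq {d : ℕ} {a b lam : ℝ}
    (h : tridiagSeq a (2 - lam) (d + 1) = b * tridiagSeq a (2 - lam) d) :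
    (tridiag d a b).mulVec (fun j => tridiagSeq a (2 - lam) (j + 1)) =
      lam • fun j : Fin d => tridiagSeq a (2 - lam) (j + 1) := by
  funext i
  rw [tridiag_mulVec (by simp [tridiagSeq]) h, Pi.smul_apply, smul_eq_mul, tridiagSeq]
  ring

/-- An eigenvector of `tridiag d a b` is a multiple of `tridiagSeq a (2 - lam)`. -/
theorem exists_eq_mul_tridiagSeq {d : ℕ} (hd : 1 ≤ d) {a b lam : ℝ} {v : Fin d → ℝ} (hv : v ≠ 0)
    (h : (tridiag d a b).mulVec v = lam • v) :
    ∃ c : ℝ, c ≠ 0 ∧ (∀ i, v i = c * tridiagSeq a (2 - lam) (i + 1)) ∧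
      tridiagSeq a (2 - lam) (d + 1) = b * tridiagSeq a (2 - lam) d := by
  let f : ℕ → ℝ := fun k =>
    if k = 0 then a * v ⟨0, hd⟩ else if hk : k - 1 < d then v ⟨k - 1, hk⟩
    else b * v ⟨d - 1, by omega⟩
  have hfv : ∀ i : Fin d, f (i + 1) = v i := fun i => by simp [f]
  have h0 : f 0 = a * f 1 := by simp [f, show 0 < d by omega]
  have hlast : f (d + 1) = b * f d := by simp [f, show d ≠ 0 by omega, show 0 < d by omega]
  have hrec : ∀ k < d, f (k + 2) = (2 - lam) * f (k + 1) - f k := by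
    intro k hk
    have h1 := tridiag_mulVec h0 hlast ⟨k, hk⟩
    simp only [hfv, h, Pi.smul_apply, smul_eq_mul] at h1
    rw [← hfv ⟨k, hk⟩] at h1
    simp only at h1
    linarith
  have hf := eq_mul_tridiagSeq h0 hrec
  have hc : f 1 ≠ 0 := by
    intro hc
    refine hv (funext fun i => ?_)
    rw [← hfv, hf _ (by omega), hc, zero_mul, Pi.zero_apply]
  refine ⟨f 1, hc, fun i => by rw [← hfv, hf _ (by omega)], mul_left_cancel₀ hc ?_⟩
  rw [← hf _ le_rfl, hlast, hf d (by omega)]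
  ring

theorem isEigen_tridiag_zero_iff {d : ℕ} {a lam : ℝ} :
    IsEigen (tridiag d a 0) lam ↔ tridiagSeq a (2 - lam) (d + 1) = 0 := by
  rcases Nat.eq_zero_or_pos d with rfl | hd
  · simp only [tridiagSeq, one_ne_zero, iff_false]
    rintro ⟨v, hv, -⟩
    exact hv (Subsingleton.elim _ _)
  constructor
  · rintro ⟨v, hv, h⟩
    obtain ⟨c, -, -, h⟩ := exists_eq_mul_tridiagSeq hd hv h
    simpa using h
  · intro h
    refine ⟨_, fun h' => ?_, tridiag_mulVec_tridiagSeq (by simpa using h)⟩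
    simpa [tridiagSeq] using congrFun h' ⟨0, hd⟩

theorem tridiagSeq_succ_ne_zero {a t : ℝ} {p : ℕ} (hp : tridiagSeq a t p = 0) :
    tridiagSeq a t (p + 1) ≠ 0 := by
  induction p with
  | zero => simp [tridiagSeq]
  | succ p ih =>
    intro h
    rw [tridiagSeq, hp] at h
    exact ih (by linarith) hp

theorem tridiagSeq_add {a t : ℝ} {p : ℕ} (hp : tridiagSeq a t p = 0) (k : ℕ) :
    tridiagSeq a t (p + k) = tridiagSeq a t (p + 1) * tridiagSeq 0 t k :=
  eq_mul_tridiagSeq (f := fun k => tridiagSeq a t (p + k)) (by simpa using hp) (d := k)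
    (fun j _ => by rw [← add_assoc, ← add_assoc, tridiagSeq]) k (by omega)

theorem tridiagSeq_add_eq_zero_iff {a t : ℝ} {p : ℕ} (hp : tridiagSeq a t p = 0) (k : ℕ) :
    tridiagSeq a t (p + k) = 0 ↔ tridiagSeq 0 t k = 0 := by
  rw [tridiagSeq_add hp, mul_eq_zero, or_iff_right (tridiagSeq_succ_ne_zero hp)]

theorem tridiagSeq_one_succ (t : ℝ) (k : ℕ) :
    tridiagSeq 1 t (k + 1) = tridiagSeq 0 t (k + 1) - tridiagSeq 0 t k := by
  have h := eq_mul_tridiagSeq (a := 1) (t := t) (d := k)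
    (f := fun k => match k with
      | 0 => 1
      | k + 1 => tridiagSeq 0 t (k + 1) - tridiagSeq 0 t k) (by simp [tridiagSeq])
    (fun j _ => by cases j <;> simp only [tridiagSeq] <;> ring) (k + 1) le_rfl
  simpa [tridiagSeq] using h.symm

theorem tridiagSeq_one_add_succ_eq_iff {t : ℝ} {p : ℕ} (hp : tridiagSeq 1 t p = 0) (q : ℕ) :
    tridiagSeq 1 t (p + q + 1) = tridiagSeq 1 t (p + q) ↔ tridiagSeq 1 t (q + 1) = 0 := by
  rw [add_assoc, tridiagSeq_add hp (q + 1), tridiagSeq_add hp q,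
    mul_right_inj' (tridiagSeq_succ_ne_zero hp), tridiagSeq_one_succ, sub_eq_zero]

/-- A nonzero vector whose orbit under a symmetric matrix vanishes on `S` yields an eigenvector
vanishing on `S`. -/
theorem exists_eigenvector_vanishing {n : ℕ} {A : Matrix (Fin n) (Fin n) ℝ} (hA : A.IsHermitian)
    (S : Set (Fin n)) {x : Fin n → ℝ} (hx : x ≠ 0) (h : ∀ k : ℕ, ∀ j ∈ S, (A ^ k).mulVec x j = 0) :
    ∃ lam : ℝ, ∃ v : Fin n → ℝ, v ≠ 0 ∧ A.mulVec v = lam • v ∧ ∀ j ∈ S, v j = 0 := by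
  let T : EuclideanSpace ℝ (Fin n) →ₗ[ℝ] EuclideanSpace ℝ (Fin n) := A.toEuclideanLin
  have hT : T.IsSymmetric := Matrix.isSymmetric_toEuclideanLin_iff.mpr hA
  let W : Submodule ℝ (EuclideanSpace ℝ (Fin n)) :=
    { carrier := {y | ∀ k : ℕ, ∀ j ∈ S, (A ^ k).mulVec y.ofLp j = 0}
      zero_mem' := fun k j _ => by simp
      add_mem' := fun {y z} hy hz k j hj => by
        simp [Matrix.mulVec_add, hy k j hj, hz k j hj]
      smul_mem' := fun c y hy k j hj => by simp [Matrix.mulVec_smul, hy k j hj] }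
  have hW : ∀ y ∈ W, T y ∈ W := by
    intro y hy k j hj
    have h1 : (T y).ofLp = A.mulVec y.ofLp := rfl
    rw [h1, Matrix.mulVec_mulVec, ← pow_succ]
    exact hy (k + 1) j hj
  have : Nontrivial W := ⟨⟨WithLp.toLp 2 x, h⟩, 0, fun h' => hx <| by
    simpa using congrArg (fun y : W => y.1.ofLp) h'⟩
  obtain ⟨v, hv⟩ :=
    (hT.restrict_invariant hW).hasEigenvalue_iSup_of_finiteDimensional.exists_hasEigenvector
  refine ⟨_, v.1.ofLp, fun h' => hv.2 ?_, congrArg (fun y : W => y.1.ofLp) hv.apply_eq_smul,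
    fun j hj => ?_⟩
  · ext j
    exact congrFun h' j
  · simpa using v.2 0 j hj

theorem Lpath_isHermitian (n : ℕ) : (Lpath n).IsHermitian := by
  ext i j
  simp only [Lpath, Matrix.conjTranspose_apply, Matrix.of_apply, star_trivial]
  split_ifs <;> first | rfl | omega

theorem pow_mulVec_of_mulVec_eq_smul {n : ℕ} {A : Matrix (Fin n) (Fin n) ℝ} {lam : ℝ}
    {v : Fin n → ℝ} (h : A.mulVec v = lam • v) (k : ℕ) : (A ^ k).mulVec v = lam ^ k • v := by
  induction k with
  | zero => simp
  | succ k ih => rw [pow_succ, ← Matrix.mulVec_mulVec, h, Matrix.mulVec_smul, ih, smul_smul,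
      pow_succ']

/-- The common eigenvalues of the blocks are characterised by `tridiagSeq` vanishing at every
observation node and satisfying the boundary condition at the end of the path. -/
theorem common_isEigen_iff {n m : ℕ} (hm : 1 ≤ m) {idx : Fin m → ℕ} (hmono : StrictMono idx)
    (hlb : ∀ j, 2 ≤ idx j) (hub : ∀ j, idx j ≤ n - 1) (lam : ℝ) :
    (IsEigen (Nmat (idx ⟨0, by omega⟩ - 1)) lam ∧
        (∀ j : Fin (m - 1),
          IsEigen (Mmat (idx ⟨(j : ℕ) + 1, by have := j.isLt; omega⟩ -
            idx ⟨(j : ℕ), by have := j.isLt; omega⟩ - 1)) lam) ∧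
        IsEigen (Nmat (n - idx ⟨m - 1, by omega⟩)) lam) ↔
      (∀ j, tridiagSeq 1 (2 - lam) (idx j) = 0) ∧
        tridiagSeq 1 (2 - lam) (n + 1) = tridiagSeq 1 (2 - lam) n := by
  simp only [Nmat_eq_tridiag, Mmat_eq_tridiag, isEigen_tridiag_zero_iff]
  have hfirst : idx ⟨0, by omega⟩ - 1 + 1 = idx ⟨0, by omega⟩ := by
    have := hlb ⟨0, by omega⟩
    omega
  have hgap : ∀ (j : ℕ) (hj : j + 1 < m),
      idx ⟨j, by omega⟩ + (idx ⟨j + 1, hj⟩ - idx ⟨j, by omega⟩ - 1 + 1) = idx ⟨j + 1, hj⟩ := by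
    intro j hj
    have : idx ⟨j, by omega⟩ < idx ⟨j + 1, hj⟩ := hmono (by simp)
    omega
  have hend : idx ⟨m - 1, by omega⟩ + (n - idx ⟨m - 1, by omega⟩) = n := by
    have := hub ⟨m - 1, by omega⟩
    omega
  rw [hfirst]
  constructor
  · rintro ⟨h0, hM, hN⟩
    have hall : ∀ (j : ℕ) (hj : j < m), tridiagSeq 1 (2 - lam) (idx ⟨j, hj⟩) = 0 := by
      intro j
      induction j with
      | zero => exact fun _ => h0
      | succ j ih =>
        intro hj
        rw [← hgap j hj, tridiagSeq_add_eq_zero_iff (ih (by omega))]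
        exact hM ⟨j, by omega⟩
    refine ⟨fun j => hall j j.2, ?_⟩
    have := (tridiagSeq_one_add_succ_eq_iff (hall (m - 1) (by omega)) _).mpr hN
    rwa [hend] at this
  · rintro ⟨h, hlast⟩
    refine ⟨h _, fun j => ?_, (tridiagSeq_one_add_succ_eq_iff (h ⟨m - 1, by omega⟩) _).mp ?_⟩
    · rw [← tridiagSeq_add_eq_zero_iff (h ⟨j, by omega⟩), hgap j (by omega)]
      exact h _
    · rwa [hend]

/-- The path of length `n` is observable from internal nodes
`2 ≤ i_1 < ... < i_m ≤ n-1` iff the matrices `N_{i_1-1}`, `M_{i_2-i_1-1}`, ...,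
`M_{i_m-i_{m-1}-1}`, `N_{n-i_m}` have no common eigenvalue.
(Node `i ∈ {1,...,n}` corresponds to the index `i-1 : Fin n`.) -/
theorem stmt10 (n : ℕ) (hn : 3 ≤ n) (m : ℕ) (hm : 1 ≤ m) (idx : Fin m → ℕ)
    (hmono : StrictMono idx) (hlb : ∀ j, 2 ≤ idx j) (hub : ∀ j, idx j ≤ n - 1) :
    (∀ x : Fin n → ℝ,
        (∀ (k : ℕ) (j : Fin m),
          ((Lpath n) ^ k).mulVec x ⟨idx j - 1, by have := hub j; omega⟩ = 0) → x = 0) ↔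
    ¬ ∃ lam : ℝ,
        IsEigen (Nmat (idx ⟨0, by omega⟩ - 1)) lam ∧
        (∀ j : Fin (m - 1),
          IsEigen (Mmat (idx ⟨(j : ℕ) + 1, by have := j.isLt; omega⟩ -
            idx ⟨(j : ℕ), by have := j.isLt; omega⟩ - 1)) lam) ∧
        IsEigen (Nmat (n - idx ⟨m - 1, by omega⟩)) lam := by
  simp only [common_isEigen_iff hm hmono hlb hub]
  have hL := Lpath_eq_tridiag (show 2 ≤ n by omega)
  have hidx : ∀ j, idx j - 1 + 1 = idx j := fun j => by
    have := hlb j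
    omega
  constructor
  · rintro hobs ⟨lam, hzero, hlast⟩
    have hev := tridiag_mulVec_tridiagSeq (b := 1) (by rw [one_mul]; exact hlast)
    rw [← hL] at hev
    have h0 := congrFun (hobs _ fun k j => by
      rw [pow_mulVec_of_mulVec_eq_smul hev, Pi.smul_apply, smul_eq_mul]
      simp only [hidx, hzero, mul_zero]) ⟨0, by omega⟩
    simp [tridiagSeq] at h0
  · intro hno x hx
    by_contra hx0
    obtain ⟨lam, v, hv0, hv, hvS⟩ := exists_eigenvector_vanishing (Lpath_isHermitian n)
      (Set.range fun j => ⟨idx j - 1, by have := hub j; omega⟩) hx0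
      (by rintro k _ ⟨j, rfl⟩; exact hx k j)
    rw [hL] at hv
    obtain ⟨c, hc, hvc, hlast⟩ := exists_eq_mul_tridiagSeq (by omega) hv0 hv
    refine hno ⟨lam, fun j => ?_, by rw [hlast, one_mul]⟩
    have hj := hvS _ ⟨j, rfl⟩
    rw [hvc] at hj
    simpa [hidx, hc] using hj
end

section
/- Let n ≥ 3 and let i ∈ {2,...,n−1}. The path graph of length n is NOT observable from the single node i (i.e. there exists a nonzero x ∈ ℝ^n with (L_n^k x)_i = 0 for all k ∈ ℕ) if and only if there exists an odd prime p dividing n such that (n−i) ≡ (i−1) (mod p) (equivalently, p divides n − 2i + 1). -/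
lemma Lpath_mulVec {n : ℕ} (hn : 2 ≤ n) (f : ℤ → ℝ) (h0 : f (-1) = f 0)
    (h1 : f n = f (n - 1)) (j : Fin n) :
    (Lpath n).mulVec (fun k => f (k : ℕ)) j
      = 2 * f (j : ℕ) - f ((j : ℕ) - 1) - f ((j : ℕ) + 1) := by
  obtain ⟨j, hj⟩ := j
  let g : ℕ → ℝ := fun k =>
    (if j = k then ((if j = 0 then 0 else 1) + (if j + 1 = n then 0 else 1)) * f k else 0)
      - (if j + 1 = k then f k else 0) - (if k + 1 = j then f k else 0)
  have key : ∀ k : Fin n, Lpath n ⟨j, hj⟩ k * f (k : ℕ) = g k := by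
    rintro ⟨k, hk⟩
    simp only [Lpath, Matrix.of_apply, Fin.mk.injEq, g]
    split_ifs <;> first | omega | norm_num
  simp only [Matrix.mulVec, dotProduct]
  rw [Finset.sum_congr rfl fun k _ => key k, Fin.sum_univ_eq_sum_range g n,
    Finset.sum_sub_distrib, Finset.sum_sub_distrib, Finset.sum_ite_eq, Finset.sum_ite_eq]
  have hlast : j + 1 = n → f (j + 1) = f j := by
    rintro rfl
    simpa using h1
  rcases j with - | j
  · have h2 : 0 + 1 < n := by omega
    simp [h0, h2.ne, hj, h2]
    ring
  · have hj' : j < n := by omega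
    simp only [Nat.add_right_cancel_iff, Finset.sum_ite_eq', Finset.mem_range, hj, hj', if_true,
      Nat.add_one_ne_zero, if_false]
    split_ifs with h3 h4 <;> first | omega | skip
    · rw [hlast h3]
      push_cast
      rw [add_sub_cancel_right]
      ring
    · push_cast
      rw [add_sub_cancel_right]
      ring

/-- The `k`-th discrete cosine vector. -/
noncomputable def cosVec (n k : ℕ) : Fin n → ℝ :=
  fun j => Real.cos (Real.pi * k * (2 * ((j : ℕ) : ℝ) + 1) / (2 * n))

/-- The eigenvalue of `Lpath n` at `cosVec n k`. -/
noncomputable def cosEigenvalue (n k : ℕ) : ℝ := 2 - 2 * Real.cos (Real.pi * k / n)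

lemma Lpath_mulVec_cosVec {n : ℕ} (hn : 2 ≤ n) (k : ℕ) :
    (Lpath n).mulVec (cosVec n k) = cosEigenvalue n k • cosVec n k := by
  have hn' : (n : ℝ) ≠ 0 := by exact_mod_cast (by omega : n ≠ 0)
  ext j
  have h := Lpath_mulVec hn
    (fun j : ℤ => Real.cos (Real.pi * k * (2 * (j : ℝ) + 1) / (2 * n))) ?_ ?_ j
  · simp only [Int.cast_natCast] at h
    refine h.trans ?_
    simp only [cosVec, cosEigenvalue, Pi.smul_apply, smul_eq_mul]
    push_cast
    rw [show Real.pi * k * (2 * (((j : ℕ) : ℝ) - 1) + 1) / (2 * n)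
        = Real.pi * k * (2 * ((j : ℕ) : ℝ) + 1) / (2 * n) - Real.pi * k / n by field_simp; ring,
      show Real.pi * k * (2 * (((j : ℕ) : ℝ) + 1) + 1) / (2 * n)
        = Real.pi * k * (2 * ((j : ℕ) : ℝ) + 1) / (2 * n) + Real.pi * k / n by field_simp; ring,
      Real.cos_add, Real.cos_sub]
    ring
  · rw [← Real.cos_neg]
    congr 1
    push_cast
    ring
  · rw [← Real.cos_neg, ← Real.cos_add_nat_mul_two_pi _ k]
    congr 1
    push_cast
    field_simp
    ring

lemma Lpath_pow_mulVec_cosVec {n : ℕ} (hn : 2 ≤ n) (k m : ℕ) :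
    ((Lpath n) ^ m).mulVec (cosVec n k) = cosEigenvalue n k ^ m • cosVec n k := by
  induction m with
  | zero => simp
  | succ m ih =>
    rw [pow_succ, ← Matrix.mulVec_mulVec, Lpath_mulVec_cosVec hn, Matrix.mulVec_smul, ih,
      smul_smul, pow_succ, mul_comm]

lemma cosEigenvalue_injective (n : ℕ) :
    Function.Injective fun k : Fin n => cosEigenvalue n k := by
  intro a b h
  have hn : (0 : ℝ) < n := by exact_mod_cast a.pos
  have hmem : ∀ c : Fin n, Real.pi * (c : ℕ) / n ∈ Set.Icc 0 Real.pi := fun c => by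
    have hc : ((c : ℕ) : ℝ) ≤ n := by exact_mod_cast c.2.le
    refine ⟨by positivity, ?_⟩
    rw [div_le_iff₀ hn]
    exact mul_le_mul_of_nonneg_left hc Real.pi_pos.le
  have := Real.injOn_cos (hmem a) (hmem b) (by simp only [cosEigenvalue] at h; linarith)
  have hpi := Real.pi_ne_zero
  field_simp at this
  exact Fin.ext (by exact_mod_cast this)

lemma cosVec_ne_zero {n k : ℕ} (hk : k < n) : cosVec n k ≠ 0 := by
  intro h
  have hn : (0 : ℝ) < n := by exact_mod_cast (Nat.zero_le k).trans_lt hk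
  have hk' : (k : ℝ) < n := by exact_mod_cast hk
  have h0 := congrFun h ⟨0, (Nat.zero_le k).trans_lt hk⟩
  refine (Real.cos_pos_of_mem_Ioo ⟨?_, ?_⟩).ne' h0
  · have : 0 ≤ Real.pi * k * (2 * ((0 : ℕ) : ℝ) + 1) / (2 * n) := by positivity
    linarith [Real.pi_pos]
  · rw [div_lt_div_iff₀ (by positivity) two_pos]
    push_cast
    nlinarith [mul_lt_mul_of_pos_left hk' Real.pi_pos]

lemma linearIndependent_cosVec {n : ℕ} (hn : 2 ≤ n) :
    LinearIndependent ℝ fun k : Fin n => cosVec n k := by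
  refine Module.End.eigenvectors_linearIndependent' (Matrix.toLin' (Lpath n))
    (fun k : Fin n => cosEigenvalue n k) (cosEigenvalue_injective n) _ fun k => ?_
  rw [Module.End.hasEigenvector_iff, Module.End.mem_eigenspace_iff, Matrix.toLin'_apply]
  exact ⟨Lpath_mulVec_cosVec hn k, cosVec_ne_zero k.2⟩

lemma exists_cosVec_apply_eq_zero {n : ℕ} (hn : 2 ≤ n) {x : Fin n → ℝ} (hx : x ≠ 0) (j : Fin n)
    (h : ∀ m : ℕ, ((Lpath n) ^ m).mulVec x j = 0) : ∃ k < n, cosVec n k j = 0 := by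
  have : Nonempty (Fin n) := ⟨j⟩
  let B := basisOfLinearIndependentOfCardEqFinrank (linearIndependent_cosVec hn) (by simp)
  have hsum : ∑ k, B.repr x k • cosVec n k = x := by
    simpa [B] using B.sum_repr x
  obtain ⟨k, hk⟩ : ∃ k, B.repr x k ≠ 0 := by
    by_contra! hc
    exact hx (by rw [← hsum]; simp [hc])
  refine ⟨k, k.2, ?_⟩
  have hz := Matrix.eq_zero_of_forall_pow_sum_mul_pow_eq_zero (cosEigenvalue_injective n)
    (v := fun k : Fin n => B.repr x k * cosVec n k j) fun m => by
      have hm := h m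
      rw [← hsum, Matrix.mulVec_sum] at hm
      simpa [Matrix.mulVec_smul, Lpath_pow_mulVec_cosVec hn, mul_assoc, mul_left_comm,
        mul_comm] using hm
  exact (mul_eq_zero.mp (congrFun hz k)).resolve_left hk

lemma cosVec_apply_eq_zero_iff {n : ℕ} (k : ℕ) (j : Fin n) :
    cosVec n k j = 0 ↔ ∃ m : ℤ, (k : ℤ) * (2 * (j : ℕ) + 1) = n * (2 * m + 1) := by
  have hn : (n : ℝ) ≠ 0 := by exact_mod_cast j.pos.ne'
  have hpi := Real.pi_ne_zero
  rw [cosVec, Real.cos_eq_zero_iff]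
  refine exists_congr fun m => ?_
  rw [← @Int.cast_inj ℝ]
  push_cast
  constructor
  · intro h
    field_simp at h
    linarith
  · intro h
    field_simp
    linarith

/-- The path of length `n` is NOT observable from the single internal node `i`
iff `(n−i) ≡ (i−1) (mod p)` for some odd prime `p` dividing `n`
(equivalently, `p ∣ n − 2i + 1`). -/
theorem stmt11 (n : ℕ) (hn : 3 ≤ n) (i : ℕ) (hi2 : 2 ≤ i) (hi : i ≤ n - 1) :
    (∃ x : Fin n → ℝ, x ≠ 0 ∧
        ∀ k : ℕ, ((Lpath n) ^ k).mulVec x ⟨i - 1, by omega⟩ = 0) ↔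
    (∃ p : ℕ, p.Prime ∧ Odd p ∧ p ∣ n ∧
        ((n : ℤ) - (i : ℤ)) ≡ ((i : ℤ) - 1) [ZMOD (p : ℤ)]) := by
  have hcast : (2 * ((i - 1 : ℕ) : ℤ) + 1) = ((2 * i - 1 : ℕ) : ℤ) := by omega
  have hmod : ∀ p : ℕ, p ∣ n →
      (((n : ℤ) - (i : ℤ)) ≡ ((i : ℤ) - 1) [ZMOD (p : ℤ)] ↔ p ∣ 2 * i - 1) := fun p hp => by
    rw [Int.modEq_iff_dvd, ← Int.natCast_dvd_natCast, ← hcast]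
    have : ((i : ℤ) - 1 - (n - i)) = 2 * ((i - 1 : ℕ) : ℤ) + 1 - n := by omega
    rw [this, dvd_sub_left (Int.natCast_dvd_natCast.mpr hp)]
  constructor
  · rintro ⟨x, hx, h⟩
    obtain ⟨k, hk, hz⟩ := exists_cosVec_apply_eq_zero (by omega) hx _ h
    obtain ⟨m, hm⟩ := (cosVec_apply_eq_zero_iff _ _).mp hz
    simp only [hcast] at hm
    have hg : Nat.gcd n (2 * i - 1) ≠ 1 := fun hg => by
      have hdvd : n ∣ k * (2 * i - 1) := by
        rw [← Int.natCast_dvd_natCast]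
        exact ⟨2 * m + 1, by rw [Nat.cast_mul, hm]⟩
      have hk0 := Nat.eq_zero_of_dvd_of_lt (Nat.Coprime.dvd_of_dvd_mul_right hg hdvd) hk
      rw [hk0, Nat.cast_zero, zero_mul, eq_comm, mul_eq_zero] at hm
      omega
    obtain ⟨p, hp, hpd⟩ := Nat.exists_prime_and_dvd hg
    have hp2 := hpd.trans (Nat.gcd_dvd_right _ _)
    have hpn := hpd.trans (Nat.gcd_dvd_left _ _)
    exact ⟨p, hp, Odd.of_dvd_nat ⟨i - 1, by omega⟩ hp2, hpn, (hmod p hpn).mpr hp2⟩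
  · rintro ⟨p, hp, -, hpn, hpm⟩
    obtain ⟨c, hc⟩ := (hmod p hpn).mp hpm
    obtain ⟨d, rfl⟩ := hpn
    have hd : d < p * d := by
      have := hp.two_le
      rcases Nat.eq_zero_or_pos d with rfl | hd
      · simp at hn
      · nlinarith
    refine ⟨cosVec (p * d) d, cosVec_ne_zero hd, fun k => ?_⟩
    have hodd : Odd c := Odd.of_dvd_nat (n := 2 * i - 1) ⟨i - 1, by omega⟩ ⟨p, by rw [hc, mul_comm]⟩
    obtain ⟨m, rfl⟩ := hodd
    have hz := (cosVec_apply_eq_zero_iff d (⟨i - 1, by omega⟩ : Fin (p * d))).mpr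
      ⟨m, by simp only [hcast, hc]; push_cast; ring⟩
    rw [Lpath_pow_mulVec_cosVec (by omega), Pi.smul_apply, hz, smul_zero]
end

section
/- Let n ≥ 3, let p be an odd prime dividing n, and let I_o^p = { ℓp − (p−1)/2 : ℓ = 1, ..., n/p } ⊆ {1,...,n}. Then for each ν ∈ {1, ..., (p−1)/2}, setting λ_ν = 2 − 2cos((2ν−1)π/p), there exists a nonzero vector V ∈ ℝ^n with L_n V = λ_ν V and V_j = 0 for every j ∈ I_o^p. In particular, the path graph of length n is not observable from the set I_o^p. -/
/-- The action of the path Laplacian on the restriction of a sequence to the path. -/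
lemma Lpath_mulVec_apply {n : ℕ} (f : ℕ → ℝ) (i : Fin n) :
    (Lpath n).mulVec (fun j => f j) i =
      (if (i : ℕ) = 0 ∨ (i : ℕ) = n - 1 then 1 else 2) * f i
        - (if (i : ℕ) + 1 < n then f (i + 1) else 0)
        - (if 0 < (i : ℕ) then f (i - 1) else 0) := by
  obtain ⟨i, hi⟩ := i
  have hentry : ∀ j : Fin n, Lpath n ⟨i, hi⟩ j * f j =
      (if (j : ℕ) = i then (if i = 0 ∨ i = n - 1 then 1 else 2) * f i else 0)
        - (if (j : ℕ) = i + 1 then f (i + 1) else 0)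
        - (if (j : ℕ) = i - 1 then (if 0 < i then f (i - 1) else 0) else 0) := by
    rintro ⟨j, hj⟩
    simp only [Lpath, Matrix.of_apply, Fin.mk.injEq]
    rcases lt_trichotomy i j with h | rfl | h
    · rw [if_neg (by omega : ¬ i = j), if_neg (by omega : ¬ j = i),
        if_neg (by omega : ¬ j = i - 1)]
      by_cases hij : j = i + 1
      · subst hij; simp
      · rw [if_neg (by omega), if_neg hij]; simp
    · by_cases h0 : 0 < i
      · rw [if_neg (by omega : ¬ i = i - 1)]; simp
      · simp [h0]
    · rw [if_neg (by omega : ¬ i = j), if_neg (by omega : ¬ j = i),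
        if_neg (by omega : ¬ j = i + 1), if_pos (by omega : 0 < i)]
      by_cases hij : j = i - 1
      · rw [if_pos (by omega), if_pos hij, hij]; simp
      · rw [if_neg (by omega), if_neg hij]; simp
  simp only [Matrix.mulVec, dotProduct, hentry, Finset.sum_sub_distrib]
  rw [Fin.sum_univ_eq_sum_range (fun j => if j = i then _ else (0 : ℝ)),
    Fin.sum_univ_eq_sum_range (fun j => if j = i + 1 then _ else (0 : ℝ)),
    Fin.sum_univ_eq_sum_range (fun j => if j = i - 1 then _ else (0 : ℝ))]
  simp only [Finset.sum_ite_eq', Finset.mem_range]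
  rw [if_pos hi, if_pos (by omega : i - 1 < n)]

/-- If `sin (n θ) = 0`, the vector `cos ((j + 1/2) θ)` is an eigenvector of the path Laplacian. -/
lemma Lpath_mulVec_cos {n : ℕ} (hn : 2 ≤ n) {θ : ℝ} (hθ : Real.sin (n * θ) = 0) :
    (Lpath n).mulVec (fun j => Real.cos (((j : ℕ) + 1 / 2 : ℝ) * θ)) =
      (2 - 2 * Real.cos θ) • fun j : Fin n => Real.cos (((j : ℕ) + 1 / 2 : ℝ) * θ) := by
  have hrec : ∀ x : ℝ, Real.cos ((x + 1) * θ) + Real.cos ((x - 1) * θ) =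
      2 * Real.cos θ * Real.cos (x * θ) := by
    intro x
    rw [add_mul, sub_mul, one_mul, Real.cos_add, Real.cos_sub]
    ring
  ext i
  rw [Lpath_mulVec_apply (fun j : ℕ => Real.cos ((j + 1 / 2 : ℝ) * θ)) i]
  obtain ⟨i, hi⟩ := i
  simp only [Pi.smul_apply, smul_eq_mul]
  have h := hrec (i + 1 / 2)
  rcases Nat.eq_zero_or_pos i with rfl | hpos
  · have hsymm : Real.cos ((((0 : ℕ) : ℝ) + 1 / 2 - 1) * θ) =
        Real.cos ((((0 : ℕ) : ℝ) + 1 / 2) * θ) := by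
      rw [← Real.cos_neg]
      congr 1
      push_cast
      ring
    rw [if_pos (Or.inl rfl), if_pos (by omega), if_neg (by omega)]
    rw [hsymm, show (((0 : ℕ) : ℝ) + 1 / 2 + 1) = ((0 + 1 : ℕ) : ℝ) + 1 / 2 by push_cast; ring] at h
    linarith
  have hprev : ((i : ℝ) + 1 / 2 - 1) = ((i - 1 : ℕ) : ℝ) + 1 / 2 := by
    rw [Nat.cast_pred hpos]
    ring
  rw [if_pos hpos]
  rw [hprev] at h
  by_cases hlast : i + 1 < n
  · rw [if_neg (by omega), if_pos hlast]
    rw [show ((i : ℝ) + 1 / 2 + 1) = ((i + 1 : ℕ) : ℝ) + 1 / 2 by push_cast; ring] at h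
    linarith
  · have hcast : (n : ℝ) = i + 1 := by exact_mod_cast (by omega : n = i + 1)
    have hsymm : Real.cos (((i : ℝ) + 1 / 2 + 1) * θ) = Real.cos (((i : ℝ) + 1 / 2) * θ) := by
      rw [show ((i : ℝ) + 1 / 2 + 1) * θ = n * θ + θ / 2 by rw [hcast]; ring,
        show ((i : ℝ) + 1 / 2) * θ = n * θ - θ / 2 by rw [hcast]; ring,
        Real.cos_add, Real.cos_sub, hθ]
      ring
    rw [if_pos (by omega), if_neg hlast]
    rw [hsymm] at h
    linarith

lemma Matrix.pow_mulVec_of_eigenvector {m R : Type*} [Fintype m] [DecidableEq m] [CommSemiring R]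
    {A : Matrix m m R} {v : m → R} {μ : R} (h : A.mulVec v = μ • v) (k : ℕ) :
    (A ^ k).mulVec v = μ ^ k • v := by
  induction k with
  | zero => simp
  | succ k ih => rw [pow_succ, ← Matrix.mulVec_mulVec, h, Matrix.mulVec_smul, ih, smul_smul, pow_succ']

/-- For an odd prime `p ∣ n` and the set of nodes
`I_o^p = { ℓp − (p−1)/2 : ℓ = 1, ..., n/p }` (a node with label `i ∈ {1,...,n}`
corresponds to the index `j : Fin n` with `(j:ℕ)+1 = i`), every
`λ_ν = 2 − 2cos((2ν−1)π/p)`, `ν ∈ {1,...,(p−1)/2}`, is an eigenvalue of `L_n`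
with an eigenvector vanishing on `I_o^p`; in particular the path is not
observable from `I_o^p`. -/
theorem stmt13 (n : ℕ) (hn : 3 ≤ n) (p : ℕ) (hp : p.Prime) (hodd : Odd p)
    (hpn : p ∣ n) (ν : ℕ) (hν1 : 1 ≤ ν) (hν2 : ν ≤ (p - 1) / 2) :
    (∃ V : Fin n → ℝ, V ≠ 0 ∧
        (Lpath n).mulVec V =
          (2 - 2 * Real.cos ((2 * (ν : ℝ) - 1) * Real.pi / (p : ℝ))) • V ∧
        ∀ j : Fin n,
          (∃ ℓ : ℕ, 1 ≤ ℓ ∧ ℓ ≤ n / p ∧ (j : ℕ) + 1 = ℓ * p - (p - 1) / 2) →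
            V j = 0) ∧
    (∃ x : Fin n → ℝ, x ≠ 0 ∧
        ∀ (k : ℕ) (j : Fin n),
          (∃ ℓ : ℕ, 1 ≤ ℓ ∧ ℓ ≤ n / p ∧ (j : ℕ) + 1 = ℓ * p - (p - 1) / 2) →
            ((Lpath n) ^ k).mulVec x j = 0) := by
  have hp0 : (p : ℝ) ≠ 0 := by exact_mod_cast hp.ne_zero
  set θ : ℝ := (2 * (ν : ℝ) - 1) * Real.pi / (p : ℝ) with hθ
  obtain ⟨q, hq⟩ := hodd
  have hsin : Real.sin (n * θ) = 0 := by
    obtain ⟨m, rfl⟩ := hpn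
    rw [Real.sin_eq_zero_iff]
    refine ⟨m * (2 * ν - 1), ?_⟩
    rw [hθ]
    push_cast
    field_simp
  let V : Fin n → ℝ := fun j => Real.cos (((j : ℕ) + 1 / 2 : ℝ) * θ)
  have heig : (Lpath n).mulVec V = (2 - 2 * Real.cos θ) • V := Lpath_mulVec_cos (by omega) hsin
  have hV : V ≠ 0 := by
    intro h
    have hpos : 0 < (p : ℝ) := by exact_mod_cast hp.pos
    have hν : (1 : ℝ) ≤ ν := by exact_mod_cast hν1
    have hνp : (2 * ν : ℝ) ≤ p := by exact_mod_cast (by omega : 2 * ν ≤ p)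
    have hθ0 : 0 < θ := by
      have : 0 < 2 * (ν : ℝ) - 1 := by linarith
      positivity
    have hθπ : θ < Real.pi := by
      rw [hθ, div_lt_iff₀ hpos]
      nlinarith [Real.pi_pos]
    have hcos : 0 < Real.cos (((0 : ℕ) + 1 / 2 : ℝ) * θ) :=
      Real.cos_pos_of_mem_Ioo ⟨by push_cast; linarith, by push_cast; linarith⟩
    exact hcos.ne' (congrFun h ⟨0, by omega⟩)
  have hvanish : ∀ j : Fin n,
      (∃ ℓ : ℕ, 1 ≤ ℓ ∧ ℓ ≤ n / p ∧ (j : ℕ) + 1 = ℓ * p - (p - 1) / 2) → V j = 0 := by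
    rintro j ⟨ℓ, hℓ, -, hj⟩
    have hle : p ≤ ℓ * p := Nat.le_mul_of_pos_left p hℓ
    have hnat : 2 * (j : ℕ) + 1 + p = 2 * (ℓ * p) := by omega
    have hreal : 2 * ((j : ℕ) : ℝ) + 1 + p = 2 * (ℓ * p) := by exact_mod_cast hnat
    have hmid : ((j : ℕ) : ℝ) + 1 / 2 = (2 * ℓ - 1) * p / 2 := by linarith
    refine Real.cos_eq_zero_iff.2 ⟨2 * ℓ * ν - ℓ - ν, ?_⟩
    rw [hmid, hθ]
    push_cast
    field_simp
    ring
  refine ⟨⟨V, hV, heig, hvanish⟩, V, hV, fun k j hj => ?_⟩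
  rw [Matrix.pow_mulVec_of_eigenvector heig, Pi.smul_apply, hvanish j hj, smul_zero]
end

section
/- Let n ≥ 3. The cycle graph of length n is not observable from any single node: for every i ∈ {1,...,n}, there exists a nonzero x ∈ ℝ^n with (C_n^k x)_i = 0 for all k ∈ ℕ. -/
/-- The Laplacian `C_n` of the cycle graph on `n ≥ 3` nodes. -/
noncomputable def Lcycle (n : ℕ) : Matrix (Fin n) (Fin n) ℝ :=
  Matrix.of fun i j =>
    if i = j then 2
    else if (i : ℕ) + 1 = (j : ℕ) ∨ (j : ℕ) + 1 = (i : ℕ) ∨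
            ((i : ℕ) = 0 ∧ (j : ℕ) = n - 1) ∨ ((j : ℕ) = 0 ∧ (i : ℕ) = n - 1)
      then -1 else 0

open Matrix in
/-- A matrix invariant under a permutation of the nodes maps vectors that are antisymmetric under
this permutation to antisymmetric vectors, so all their iterates vanish at its fixed points. -/
theorem pow_mulVec_apply_eq_zero_of_antisymm {ι : Type*} [Fintype ι] [DecidableEq ι]
    (A : Matrix ι ι ℝ) (s : Equiv.Perm ι) (hA : ∀ a b, A (s a) (s b) = A a b) {i : ι}
    (hi : s i = i) (k : ℕ) (x : ι → ℝ) (hx : ∀ j, x (s j) = -x j) :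
    ((A ^ k) *ᵥ x) i = 0 := by
  induction k generalizing x with
  | zero =>
    have h := hx i
    rw [hi] at h
    simp only [pow_zero, one_mulVec]
    linarith
  | succ k ih =>
    rw [pow_succ, ← mulVec_mulVec]
    refine ih _ fun j => ?_
    simp only [mulVec, dotProduct]
    rw [← Equiv.sum_comp s, ← Finset.sum_neg_distrib]
    exact Finset.sum_congr rfl fun b _ => by rw [hA, hx, mul_neg]

theorem Lcycle_apply (m : ℕ) (hm : 2 ≤ m) (a b : Fin (m + 1)) :
    Lcycle (m + 1) a b = if a = b then 2 else if b = a + 1 ∨ a = b + 1 then -1 else 0 := by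
  have h : ((a : ℕ) + 1 = b ∨ (b : ℕ) + 1 = a ∨ ((a : ℕ) = 0 ∧ (b : ℕ) = m + 1 - 1) ∨
      ((b : ℕ) = 0 ∧ (a : ℕ) = m + 1 - 1)) ↔ (b = a + 1 ∨ a = b + 1) := by
    have ha := a.isLt
    have hb := b.isLt
    simp only [Fin.ext_iff, Fin.val_add_one, Fin.val_last]
    split_ifs <;> omega
  simp only [Lcycle, Matrix.of_apply, h]

theorem Lcycle_sub_left (m : ℕ) (hm : 2 ≤ m) (c a b : Fin (m + 1)) :
    Lcycle (m + 1) (c - a) (c - b) = Lcycle (m + 1) a b := by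
  have h (a b : Fin (m + 1)) : c - b = c - a + 1 ↔ a = b + 1 := by
    rw [sub_add, sub_right_inj, eq_comm, sub_eq_iff_eq_add]
  simp only [Lcycle_apply m hm, sub_right_inj, h, or_comm]

/-- A cycle of length `n ≥ 3` is not observable from any single node. -/
theorem stmt16 (n : ℕ) (hn : 3 ≤ n) (i : Fin n) :
    ∃ x : Fin n → ℝ, x ≠ 0 ∧ ∀ k : ℕ, ((Lcycle n) ^ k).mulVec x i = 0 := by
  obtain ⟨m, rfl⟩ : ∃ m, n = m + 1 := ⟨n - 1, by omega⟩
  have hm : 2 ≤ m := by omega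
  refine ⟨Pi.single (i + 1) 1 - Pi.single (i - 1) 1, fun h => ?_, fun k =>
    pow_mulVec_apply_eq_zero_of_antisymm _ (Equiv.subLeft (i + i))
      (fun a b => Lcycle_sub_left m hm (i + i) a b) (by simp) k _ fun j => ?_⟩
  · have hne : i + 1 ≠ i - 1 := by
      intro h
      have h2 : (1 : Fin (m + 1)) + 1 = 0 := by
        rw [sub_eq_add_neg, add_right_inj] at h
        exact eq_neg_iff_add_eq_zero.mp h
      have h3 := congrArg Fin.val h2
      rw [Fin.val_add, Fin.val_one', Nat.mod_eq_of_lt (by omega : 1 < m + 1),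
        Nat.mod_eq_of_lt (by omega)] at h3
      simp at h3
    simpa [Pi.single_apply, hne] using congrFun h (i + 1)
  · have h1 : i + i - j = i + 1 ↔ j = i - 1 := by
      constructor <;> intro h
      · rw [sub_eq_iff_eq_add] at h
        rw [eq_sub_iff_add_eq]
        apply add_left_cancel (a := i)
        rw [h]; abel
      · rw [h]; abel
    have h2 : i + i - j = i - 1 ↔ j = i + 1 := by
      constructor <;> intro h
      · rw [sub_eq_iff_eq_add] at h
        apply add_left_cancel (a := i)
        rw [← add_assoc, h]; abel
      · rw [h]; abel
    simp only [Equiv.subLeft_apply, Pi.sub_apply, Pi.single_apply, h1, h2, neg_sub]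
end

section
/- Let n ≥ 3. The cycle graph of length n is observable from any two adjacent nodes; in particular, the only x ∈ ℝ^n satisfying (C_n^k x)_1 = 0 and (C_n^k x)_2 = 0 for all k ∈ ℕ is x = 0. Moreover, the cycle graph of length n is observable from every pair of distinct nodes {i_1, i_2} (1 ≤ i_1 < i_2 ≤ n) if and only if n is prime. -/
/-- The `n`-periodic extension to `ℤ` of a vector indexed by `Fin n`. -/
def periodicExtension {n : ℕ} [NeZero n] (x : Fin n → ℝ) (k : ℤ) : ℝ :=
  x (Fin.ofNat n (k % n).toNat)

section

variable {n : ℕ} [NeZero n]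

lemma emod_toNat_lt (k : ℤ) : (k % n).toNat < n := by
  have h0 : (0 : ℤ) < n := by exact_mod_cast Nat.pos_of_neZero n
  have := Int.emod_nonneg k h0.ne'
  have := Int.emod_lt_of_pos k h0
  omega

lemma val_ofNat_emod_toNat (k : ℤ) :
    ((Fin.ofNat n (k % n).toNat : Fin n) : ℕ) = (k % n).toNat :=
  Nat.mod_eq_of_lt (emod_toNat_lt k)

lemma periodicExtension_natCast (x : Fin n → ℝ) (k : ℕ) (hk : k < n) :
    periodicExtension x k = x ⟨k, hk⟩ := by
  unfold periodicExtension
  congr 1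
  ext
  rw [val_ofNat_emod_toNat, Int.emod_eq_of_lt (by omega) (by omega)]
  simp

lemma periodicExtension_periodic (x : Fin n → ℝ) :
    Function.Periodic (periodicExtension x) (n : ℤ) := by
  intro k
  simp [periodicExtension]

lemma periodicExtension_eq_zero_iff (x : Fin n → ℝ) :
    (∀ k, periodicExtension x k = 0) ↔ x = 0 := by
  refine ⟨fun h => ?_, fun h k => by simp [h, periodicExtension]⟩
  ext i
  simpa [periodicExtension_natCast x i i.2] using h (i : ℕ)

lemma Lcycle_ofNat_emod (hn : 3 ≤ n) (k : ℤ) (j : Fin n) :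
    Lcycle n (Fin.ofNat n (k % n).toNat) j =
      (if Fin.ofNat n (k % n).toNat = j then 2 else 0)
        - (if Fin.ofNat n ((k + 1) % n).toNat = j then 1 else 0)
        - (if Fin.ofNat n ((k - 1) % n).toNat = j then 1 else 0) := by
  have h0 : (0 : ℤ) < n := by omega
  have hk0 := Int.emod_nonneg k h0.ne'
  have hk1 := Int.emod_lt_of_pos k h0
  have hs : (k + 1) % n = if k % n = n - 1 then 0 else k % n + 1 := by
    rw [← Int.emod_add_emod]
    split_ifs with h
    · rw [h]; simp
    · exact Int.emod_eq_of_lt (by omega) (by omega)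
  have hp : (k - 1) % n = if k % n = 0 then (n : ℤ) - 1 else k % n - 1 := by
    rw [← Int.emod_sub_emod]
    split_ifs with h
    · rw [h, ← Int.add_emod_right]
      exact Int.emod_eq_of_lt (by omega) (by omega) |>.trans (by ring)
    · exact Int.emod_eq_of_lt (by omega) (by omega)
  have hj := j.2
  simp only [Lcycle, Matrix.of_apply, Fin.ext_iff, val_ofNat_emod_toNat]
  rw [hs, hp]
  generalize k % (n : ℤ) = r at *
  split_ifs <;> first | omega | norm_num

lemma periodicExtension_Lcycle_mulVec (hn : 3 ≤ n) (x : Fin n → ℝ) (k : ℤ) :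
    periodicExtension ((Lcycle n).mulVec x) k =
      2 * periodicExtension x k - periodicExtension x (k + 1) - periodicExtension x (k - 1) := by
  simp only [periodicExtension, Matrix.mulVec, dotProduct, Lcycle_ofNat_emod hn, sub_mul,
    Finset.sum_sub_distrib, ite_mul, zero_mul, one_mul, Finset.sum_ite_eq, Finset.mem_univ,
    if_true]

/-- Vanishing of all outputs at a node forces antisymmetry about that node. -/
lemma periodicExtension_add_add_sub_eq_zero (hn : 3 ≤ n) (p : ℤ) (m : ℕ) (x : Fin n → ℝ)
    (hx : ∀ k : ℕ, periodicExtension ((Lcycle n ^ k).mulVec x) p = 0) :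
    periodicExtension x (p + m) + periodicExtension x (p - m) = 0 := by
  induction m using Nat.twoStepInduction generalizing x with
  | zero => simpa using hx 0
  | one =>
    have h1 := hx 1
    have h0 := hx 0
    rw [pow_one, periodicExtension_Lcycle_mulVec hn] at h1
    simp only [pow_zero, Matrix.one_mulVec] at h0
    push_cast
    linarith
  | more m ih0 ih1 =>
    have hC := ih1 ((Lcycle n).mulVec x) fun k => by
      rw [Matrix.mulVec_mulVec, ← pow_succ]
      exact hx (k + 1)
    have h0 := ih0 x hx
    have h1 := ih1 x hx
    simp only [periodicExtension_Lcycle_mulVec hn] at hC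
    push_cast at *
    rw [show p + ((m : ℤ) + 1) + 1 = p + (m + 2) by ring,
      show p + ((m : ℤ) + 1) - 1 = p + m by ring,
      show p - ((m : ℤ) + 1) + 1 = p - m by ring,
      show p - ((m : ℤ) + 1) - 1 = p - (m + 2) by ring] at hC
    linarith

lemma periodicExtension_reflect (hn : 3 ≤ n) (p : ℤ) (x : Fin n → ℝ)
    (hx : ∀ k : ℕ, periodicExtension ((Lcycle n ^ k).mulVec x) p = 0) (m : ℤ) :
    periodicExtension x (p + m) = - periodicExtension x (p - m) := by
  obtain ⟨a, rfl | rfl⟩ := m.eq_nat_or_neg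
  · linarith [periodicExtension_add_add_sub_eq_zero hn p a x hx]
  · have := periodicExtension_add_add_sub_eq_zero hn p a x hx
    rw [sub_neg_eq_add, ← sub_eq_add_neg]
    linarith

/-- The cycle is observable from two nodes whose distance is coprime to `n`. -/
lemma eq_zero_of_isCoprime (hn : 3 ≤ n) (p d : ℤ) (hd : IsCoprime d (n : ℤ)) (x : Fin n → ℝ)
    (hp : ∀ k : ℕ, periodicExtension ((Lcycle n ^ k).mulVec x) p = 0)
    (hq : ∀ k : ℕ, periodicExtension ((Lcycle n ^ k).mulVec x) (p + d) = 0) : x = 0 := by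
  have hper : Function.Periodic (periodicExtension x) (2 * d) := by
    intro k
    have h1 := periodicExtension_reflect hn p x hp (p - k)
    have h2 := periodicExtension_reflect hn (p + d) x hq (d + k - p)
    rw [show p + d + (d + k - p) = k + 2 * d by ring,
      show p + d - (d + k - p) = p + (p - k) by ring] at h2
    rw [h2, h1]
    simp
  have hp0 : periodicExtension x p = 0 := by simpa using hp 0
  have hq0 : periodicExtension x (p + d) = 0 := by simpa using hq 0
  rw [← periodicExtension_eq_zero_iff]
  intro k
  obtain ⟨u, v, huv⟩ := hd
  have hk : k = p + (k - p) * u * d + (k - p) * v * n := by linear_combination (p - k) * huv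
  rw [hk]
  have hP := (periodicExtension_periodic x).int_mul ((k - p) * v)
  rw [Int.cast_id] at hP
  rw [hP]
  obtain ⟨w, hw⟩ := Int.even_or_odd' ((k - p) * u)
  have hD := hper.int_mul w
  rw [Int.cast_id] at hD
  rcases hw with hw | hw <;> rw [hw]
  · rw [show p + 2 * w * d = p + w * (2 * d) by ring, hD, hp0]
  · rw [show p + (2 * w + 1) * d = p + d + w * (2 * d) by ring, hD, hq0]

end

/-- If `m ∣ n`, then `k ↦ sin (2πk/m)` is an eigenvector of the Laplacian of the cycle. -/
lemma Lcycle_mulVec_sin {n m : ℕ} (hn : 3 ≤ n) (hm : m ≠ 0) (hmn : m ∣ n) :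
    (Lcycle n).mulVec (fun i : Fin n => Real.sin (2 * Real.pi * (i : ℕ) / m)) =
      (2 - 2 * Real.cos (2 * Real.pi / m)) •
        (fun i : Fin n => Real.sin (2 * Real.pi * (i : ℕ) / m)) := by
  have : NeZero n := ⟨by omega⟩
  have hm0 : (m : ℝ) ≠ 0 := by exact_mod_cast hm
  obtain ⟨c, hc⟩ := hmn
  have hy : ∀ k : ℤ, periodicExtension (fun i : Fin n => Real.sin (2 * Real.pi * (i : ℕ) / m)) k
      = Real.sin (2 * Real.pi * k / m) := by
    intro k
    have hn0 : (n : ℤ) ≠ 0 := by omega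
    have hr : (((k % n).toNat : ℕ) : ℝ) = ((k % n : ℤ) : ℝ) := by
      exact_mod_cast congrArg (Int.cast : ℤ → ℝ) (Int.toNat_of_nonneg (Int.emod_nonneg k hn0))
    have hk : (k : ℝ) = ((k % n : ℤ) : ℝ) + n * ((k / n : ℤ) : ℝ) := by
      exact_mod_cast (Int.emod_add_mul_ediv k n).symm
    have hcn : (n : ℝ) = m * c := by exact_mod_cast hc
    simp only [periodicExtension, val_ofNat_emod_toNat]
    rw [hr, hk, ← Real.sin_add_int_mul_two_pi _ (c * (k / n))]
    congr 1
    rw [hcn]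
    push_cast
    field_simp
  ext i
  have h := periodicExtension_Lcycle_mulVec hn
    (fun i : Fin n => Real.sin (2 * Real.pi * (i : ℕ) / m)) (i : ℕ)
  rw [hy, hy, hy, periodicExtension_natCast _ _ i.2] at h
  rw [h]
  push_cast
  rw [show 2 * Real.pi * ((i : ℕ) + 1 : ℝ) / m = 2 * Real.pi * (i : ℕ) / m + 2 * Real.pi / m by
      ring,
    show 2 * Real.pi * ((i : ℕ) - 1 : ℝ) / m = 2 * Real.pi * (i : ℕ) / m - 2 * Real.pi / m by
      ring, Real.sin_add, Real.sin_sub, Pi.smul_apply, smul_eq_mul]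
  ring

/-- If some `m ≥ 3` divides both `n` and `2 * d`, then the cycle is not observable from two nodes
at distance `d`. -/
lemma exists_unobservable {n m d : ℕ} (hn : 3 ≤ n) (hm : 3 ≤ m) (hmn : m ∣ n) (hmd : m ∣ 2 * d) :
    ∃ x : Fin n → ℝ, x ≠ 0 ∧ ∀ (k : ℕ) (i : Fin n), ((i : ℕ) = 0 ∨ (i : ℕ) = d) →
      (Lcycle n ^ k).mulVec x i = 0 := by
  have hm0 : (m : ℝ) ≠ 0 := by exact_mod_cast (by omega : m ≠ 0)
  refine ⟨fun i => Real.sin (2 * Real.pi * (i : ℕ) / m), fun h => ?_, fun k i hi => ?_⟩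
  · have h1 := congrFun h ⟨1, by omega⟩
    have hm3 : (3 : ℝ) ≤ m := by exact_mod_cast hm
    refine (Real.sin_pos_of_pos_of_lt_pi (x := 2 * Real.pi / m) (by positivity) ?_).ne'
      (by simpa using h1)
    rw [div_lt_iff₀ (by positivity)]
    nlinarith [Real.pi_pos]
  · have hpow : ∀ k : ℕ,
        (Lcycle n ^ k).mulVec (fun i : Fin n => Real.sin (2 * Real.pi * (i : ℕ) / m)) =
          (2 - 2 * Real.cos (2 * Real.pi / m)) ^ k •
            (fun i : Fin n => Real.sin (2 * Real.pi * (i : ℕ) / m)) := by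
      intro k
      induction k with
      | zero => simp
      | succ k ih =>
        rw [pow_succ, ← Matrix.mulVec_mulVec, Lcycle_mulVec_sin hn (by omega) hmn,
          Matrix.mulVec_smul, ih, smul_smul, pow_succ, mul_comm]
    rw [hpow, Pi.smul_apply, smul_eq_mul]
    refine mul_eq_zero_of_right _ ?_
    rcases hi with hi | hi
    · simp [hi]
    · obtain ⟨c, hc⟩ := hmd
      have hc' : 2 * (d : ℝ) = m * c := by exact_mod_cast hc
      rw [hi, show 2 * Real.pi * (d : ℝ) / m = c * Real.pi by
        field_simp; linear_combination hc']
      exact Real.sin_nat_mul_pi c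

lemma exists_dvd_two_mul_of_not_prime {n : ℕ} (hn : 3 ≤ n) (h : ¬ n.Prime) :
    ∃ m d : ℕ, 3 ≤ m ∧ m ∣ n ∧ m ∣ 2 * d ∧ 0 < d ∧ d < n := by
  rcases Nat.even_or_odd' n with ⟨c, rfl | hc⟩
  · exact ⟨2 * c, c, hn, dvd_rfl, dvd_rfl, by omega, by omega⟩
  · have h2 : 2 ≤ n.minFac := (Nat.minFac_prime (by omega)).two_le
    have hne : n.minFac ≠ 2 := fun h => by
      have := Nat.minFac_dvd n
      rw [h] at this
      omega
    exact ⟨n.minFac, n.minFac, by omega, Nat.minFac_dvd n, Dvd.intro_left 2 rfl, by omega,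
      (Nat.not_prime_iff_minFac_lt (by omega)).1 h⟩

/-- A cycle of length `n ≥ 3` is observable from any two adjacent nodes
(the neighbor of the node with index `i` being the node with index
`(i+1) mod n`); and it is observable from every pair of distinct nodes iff `n`
is prime. (Node `i ∈ {1,...,n}` corresponds to the index `i-1 : Fin n`.) -/
theorem stmt19 (n : ℕ) (hn : 3 ≤ n) :
    (∀ i : Fin n, ∀ x : Fin n → ℝ,
        (∀ k : ℕ, ((Lcycle n) ^ k).mulVec x i = 0 ∧
          ((Lcycle n) ^ k).mulVec x ⟨((i : ℕ) + 1) % n, Nat.mod_lt _ (by omega)⟩ = 0) →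
        x = 0) ∧
    ((∀ (i₁ i₂ : ℕ) (h1 : 1 ≤ i₁) (h2 : i₁ < i₂) (h3 : i₂ ≤ n),
        ∀ x : Fin n → ℝ,
          (∀ k : ℕ, ((Lcycle n) ^ k).mulVec x ⟨i₁ - 1, by omega⟩ = 0 ∧
            ((Lcycle n) ^ k).mulVec x ⟨i₂ - 1, by omega⟩ = 0) → x = 0) ↔
      n.Prime) := by
  have : NeZero n := ⟨by omega⟩
  refine ⟨fun i x hx => ?_, fun h => ?_, fun h i₁ i₂ h1 h2 h3 x hx => ?_⟩
  · refine eq_zero_of_isCoprime hn (i : ℕ) 1 isCoprime_one_left x (fun k => ?_) (fun k => ?_)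
    · rw [periodicExtension_natCast _ _ i.2]
      exact (hx k).1
    · rw [← (hx k).2, periodicExtension]
      congr 1
      ext
      rw [val_ofNat_emod_toNat]
      exact_mod_cast Int.toNat_natCast _
  · by_contra hnp
    obtain ⟨m, d, hm, hmn, hmd, hd0, hdn⟩ := exists_dvd_two_mul_of_not_prime hn hnp
    obtain ⟨x, hx0, hx⟩ := exists_unobservable hn hm hmn hmd
    exact hx0 (h 1 (d + 1) le_rfl (by omega) (by omega) x fun k =>
      ⟨hx k _ (Or.inl rfl), hx k _ (Or.inr rfl)⟩)
  · have hcop : IsCoprime ((i₂ - i₁ : ℕ) : ℤ) (n : ℤ) :=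
      Nat.isCoprime_iff_coprime.2
        (Nat.coprime_of_lt_prime (by omega) (by omega) h).symm
    refine eq_zero_of_isCoprime hn ((i₁ - 1 : ℕ) : ℤ) _ hcop x (fun k => ?_) (fun k => ?_)
    · rw [periodicExtension_natCast _ _ (by omega)]
      exact (hx k).1
    · rw [show ((i₁ - 1 : ℕ) : ℤ) + ((i₂ - i₁ : ℕ) : ℤ) = ((i₂ - 1 : ℕ) : ℤ) by omega,
        periodicExtension_natCast _ _ (by omega)]
      exact (hx k).2
end
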